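/- Let κ : ℤ → ℝ be defined by κ(0) = 0 and κ(n) = 1/|n| for n ≠ 0. For x ∈ ℝ ∖ ℤ let h(x) = (1/2)·Σ_{n∈ℤ} [ 1/|x+n| − κ(n) ]. Let R > 0 and let S : ℝ² → ℝ be a smooth harmonic function with S(0,0) = 0 and partial derivative S₁ = ∂S/∂c₁ satisfying S₁(0,0) > −inf_{x∈(0,1)} h(x). For (c₁,c₂,θ) with R²(c₁² + c₂²) + (θ/2π + n)² > 0 for every n ∈ ℤ, define V₀(c₁,c₂,θ) = (R/4π)·( Σ_{n∈ℤ}[ (R²(c₁²+c₂²) + (θ/2π + n)²)^{−1/2} − κ(n) ] + 2·S₁(c₁,c₂) ). Then there exists ε > 0 such that V₀(c₁,c₂,θ) > 0 for every such point with c₁² + c₂² < ε². -/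

import Mathlib

lemma aux_sqrt_le (r y : ℝ) (hr : 0 ≤ r) : Real.sqrt (r ^ 2 + y ^ 2) ≤ r + |y| := by
  apply Real.sqrt_le_iff.2
  refine ⟨by positivity, ?_⟩
  nlinarith [sq_abs y, mul_nonneg hr (abs_nonneg y)]

lemma aux_le_sqrt (r y : ℝ) : |y| ≤ Real.sqrt (r ^ 2 + y ^ 2) := by
  apply Real.abs_le_sqrt
  nlinarith [sq_nonneg r]

lemma aux_sq_summable : Summable (fun n : ℤ => 1 / (n : ℝ) ^ 2) :=
  Real.summable_one_div_int_pow.2 (by norm_num)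

lemma aux_summable (κ : ℤ → ℝ) (hκ : ∀ n : ℤ, n ≠ 0 → κ n = 1 / |(n : ℝ)|)
    (r x : ℝ) (hr : 0 ≤ r) :
    Summable (fun n : ℤ => 1 / Real.sqrt (r ^ 2 + (x + n) ^ 2) - κ n) := by
  refine Summable.of_norm_bounded_eventually (aux_sq_summable.mul_left (2 * (r + |x|))) ?_
  have hfin : (Set.Icc (-⌈2 * |x|⌉) ⌈2 * |x|⌉ : Set ℤ).Finite := Set.finite_Icc _ _
  refine (hfin.subset ?_)
  intro n hn
  by_contra hcon
  apply hn
  have hbig : 2 * |x| < |(n : ℝ)| := by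
    by_contra hlt
    push Not at hlt
    apply hcon
    have h1 : |(n : ℝ)| ≤ (⌈2 * |x|⌉ : ℝ) := hlt.trans (Int.le_ceil _)
    have h2 : |n| ≤ ⌈2 * |x|⌉ := by exact_mod_cast h1
    exact abs_le.1 h2
  have hn0 : 0 < |(n : ℝ)| := lt_of_le_of_lt (by positivity) hbig
  have hne : n ≠ 0 := by
    rintro rfl
    simp at hn0
  have hs1 := aux_sqrt_le r (x + n) hr
  have hs2 := aux_le_sqrt r (x + n)
  have t1 : |x + n| ≤ |x| + |(n : ℝ)| := abs_add_le _ _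
  have t2 : |(n : ℝ)| ≤ |x + n| + |x| := by
    have := abs_sub (x + (n : ℝ)) x
    simpa using this
  set s := Real.sqrt (r ^ 2 + (x + n) ^ 2) with hs
  have hs0 : |(n : ℝ)| / 2 ≤ s := by linarith
  have hspos : 0 < s := by linarith
  show ‖1 / s - κ n‖ ≤ 2 * (r + |x|) * (1 / (n : ℝ) ^ 2)
  rw [hκ n hne, ← sq_abs (n : ℝ)]
  generalize |(n : ℝ)| = N at *
  have e : 1 / s - 1 / N = (N - s) / (s * N) := by
    field_simp
  rw [e, Real.norm_eq_abs, abs_div, abs_of_pos (mul_pos hspos hn0), mul_one_div,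
    div_le_div_iff₀ (by positivity) (by positivity)]
  have hd : |N - s| ≤ r + |x| := abs_le.2 ⟨by linarith, by linarith⟩
  have hx := abs_nonneg x
  calc |N - s| * N ^ 2 ≤ (r + |x|) * N ^ 2 := by gcongr
    _ = (r + |x|) * (N * N) := by ring
    _ ≤ (r + |x|) * (2 * s * N) := by gcongr; linarith
    _ = _ := by ring

lemma aux_even (κ : ℤ → ℝ) (hκ : ∀ n : ℤ, n ≠ 0 → κ n = 1 / |(n : ℝ)|) (n : ℤ) :
    κ (-n) = κ n := by
  by_cases hn : n = 0
  · simp [hn]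
  · rw [hκ n hn, hκ (-n) (by simpa using hn)]
    simp

lemma aux_reflect (κ : ℤ → ℝ) (hκ : ∀ n : ℤ, n ≠ 0 → κ n = 1 / |(n : ℝ)|) (r x : ℝ) :
    ∑' n : ℤ, (1 / Real.sqrt (r ^ 2 + (-x + n) ^ 2) - κ n)
      = ∑' n : ℤ, (1 / Real.sqrt (r ^ 2 + (x + n) ^ 2) - κ n) := by
  rw [← (Equiv.neg ℤ).tsum_eq (fun n : ℤ => 1 / Real.sqrt (r ^ 2 + (-x + n) ^ 2) - κ n)]
  apply tsum_congr
  intro n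
  simp only [Equiv.neg_apply, aux_even κ hκ]
  congr 4
  push_cast
  ring

lemma aux_period (κ : ℤ → ℝ) (hκ : ∀ n : ℤ, n ≠ 0 → κ n = 1 / |(n : ℝ)|) (r x : ℝ)
    (hr : 0 ≤ r) (k : ℤ) :
    ∑' n : ℤ, (1 / Real.sqrt (r ^ 2 + (x + k + n) ^ 2) - κ n)
      = ∑' n : ℤ, (1 / Real.sqrt (r ^ 2 + (x + n) ^ 2) - κ n) := by
  have s1 := aux_summable κ hκ r (x + k) hr
  have s2 := aux_summable κ hκ r x hr
  have s3 := (Equiv.addRight k).summable_iff.2 s2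
  have e3 := (Equiv.addRight k).tsum_eq
    (fun n : ℤ => 1 / Real.sqrt (r ^ 2 + (x + n) ^ 2) - κ n)
  have hsub := s1.tsum_sub s3
  have hD : ∑' n : ℤ, (κ (n + k) - κ n) = 0 := by
    have h1 := (Equiv.subLeft (-k)).tsum_eq (fun n : ℤ => κ (n + k) - κ n)
    have h2 : ∑' n : ℤ, (κ ((Equiv.subLeft (-k)) n + k) - κ ((Equiv.subLeft (-k)) n))
        = ∑' n : ℤ, -(κ (n + k) - κ n) := by
      apply tsum_congr
      intro n
      have a1 : (Equiv.subLeft (-k)) n + k = -n := by simp; ring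
      have a2 : (Equiv.subLeft (-k)) n = -(n + k) := by simp; ring
      rw [a1, a2, aux_even κ hκ, aux_even κ hκ]
      ring
    rw [h2, tsum_neg] at h1
    linarith
  have hcong : ∑' n : ℤ, ((1 / Real.sqrt (r ^ 2 + (x + k + n) ^ 2) - κ n) -
      ((fun n : ℤ => 1 / Real.sqrt (r ^ 2 + (x + n) ^ 2) - κ n) ∘ (Equiv.addRight k)) n)
      = ∑' n : ℤ, (κ (n + k) - κ n) := by
    apply tsum_congr
    intro n
    simp only [Function.comp, Equiv.coe_addRight]
    have : x + (k : ℝ) + n = x + ((n + k : ℤ) : ℝ) := by push_cast; ring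
    rw [this]
    ring
  rw [hcong, hD] at hsub
  simp only [Function.comp] at hsub
  rw [e3] at hsub
  linarith

lemma aux_abs_eq (x : ℝ) : Real.sqrt ((0 : ℝ) ^ 2 + x ^ 2) = |x| := by
  rw [← Real.sqrt_sq_eq_abs]; simp

lemma aux_summable0 (κ : ℤ → ℝ) (hκ : ∀ n : ℤ, n ≠ 0 → κ n = 1 / |(n : ℝ)|) (x : ℝ) :
    Summable (fun n : ℤ => 1 / |x + n| - κ n) := by
  have := aux_summable κ hκ 0 x le_rfl
  simpa only [aux_abs_eq] using this

lemma aux_term (r x : ℝ) (hr : 0 ≤ r) (hr' : r ≤ 1 / 4) (hx : 0 ≤ x) (hx' : x ≤ 1 / 2)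
    (hpos : 0 < x + r) (n : ℤ) (hn : 0 < r ^ 2 + (x + n) ^ 2) :
    1 / |x + r + n| - r * (16 * (1 / (n : ℝ) ^ 2)) ≤ 1 / Real.sqrt (r ^ 2 + (x + n) ^ 2) := by
  have hs := aux_sqrt_le r (x + n) hr
  have hs0 : 0 < Real.sqrt (r ^ 2 + (x + n) ^ 2) := Real.sqrt_pos.2 hn
  have h1 := one_div_le_one_div_of_le hs0 hs
  refine le_trans ?_ h1
  rcases le_or_gt 0 n with h0 | h0
  · have h0' : (0 : ℝ) ≤ n := by exact_mod_cast h0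
    rw [abs_of_nonneg (by linarith : 0 ≤ x + r + n), abs_of_nonneg (by linarith : 0 ≤ x + n)]
    have : x + r + n = r + (x + n) := by ring
    rw [this]
    have : 0 ≤ r * (16 * (1 / (n : ℝ) ^ 2)) := by positivity
    linarith
  · have h0' : (n : ℝ) ≤ -1 := by exact_mod_cast (by omega : n ≤ -1)
    rw [abs_of_neg (by linarith : x + r + n < 0), abs_of_neg (by linarith : x + n < 0)]
    obtain ⟨k, hk⟩ : ∃ k : ℝ, k = -n := ⟨_, rfl⟩
    have hk' : (n : ℝ) = -k := by linarith
    rw [hk'] at h0' ⊢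
    have hk1 : 1 ≤ k := by linarith
    have p1 : k / 4 ≤ -(x + r + -k) := by linarith
    have p2 : k / 2 ≤ r + -(x + -k) := by linarith
    have q1 : 0 < -(x + r + -k) := by linarith
    have q2 : 0 < r + -(x + -k) := by linarith
    have e : 1 / -(x + r + -k) - 1 / (r + -(x + -k))
        = 2 * r / (-(x + r + -k) * (r + -(x + -k))) := by
      rw [div_sub_div _ _ q1.ne' q2.ne']
      congr 1
      ring
    have hb : 2 * r / (-(x + r + -k) * (r + -(x + -k))) ≤ 2 * r / (k / 4 * (k / 2)) := by
      gcongr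
    have e2 : 2 * r / (k / 4 * (k / 2)) = r * (16 * (1 / (-k) ^ 2)) := by
      field_simp
      ring
    linarith

lemma aux_bdd (κ : ℤ → ℝ) (hκ0 : κ 0 = 0) (hκ : ∀ n : ℤ, n ≠ 0 → κ n = 1 / |(n : ℝ)|)
    (x : ℝ) (hx : 0 < x) (hx' : x < 1) :
    ∑' n : ℤ, -(1 / (n : ℝ) ^ 2) ≤ ∑' n : ℤ, (1 / |x + n| - κ n) := by
  refine aux_sq_summable.neg.tsum_le_tsum ?_ (aux_summable0 κ hκ x)
  intro n
  rcases lt_trichotomy n 0 with h0 | h0 | h0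
  · have h0' : (n : ℝ) ≤ -1 := by exact_mod_cast (by omega : n ≤ -1)
    rw [hκ n h0.ne, abs_of_neg (by linarith : (n : ℝ) < 0), abs_of_neg (by linarith : x + n < 0)]
    have h1 : 1 / -(n : ℝ) ≤ 1 / -(x + n) :=
      one_div_le_one_div_of_le (by linarith) (by linarith)
    have h2 : 0 ≤ 1 / (n : ℝ) ^ 2 := by positivity
    linarith
  · subst h0
    simp [hκ0]
  · have h0' : (1 : ℝ) ≤ n := by exact_mod_cast h0
    rw [hκ n h0.ne', abs_of_pos (by linarith : 0 < (n : ℝ)), abs_of_pos (by linarith : 0 < x + n)]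
    have h1 : 1 / ((n : ℝ) + 1) ≤ 1 / (x + n) :=
      one_div_le_one_div_of_le (by linarith) (by linarith)
    have h2 : 1 / (n : ℝ) - 1 / ((n : ℝ) + 1) ≤ 1 / (n : ℝ) ^ 2 := by
      rw [div_sub_div _ _ (by positivity) (by positivity),
        div_le_div_iff₀ (by positivity) (by positivity)]
      nlinarith
    linarith

lemma aux_main (κ : ℤ → ℝ) (hκ : ∀ n : ℤ, n ≠ 0 → κ n = 1 / |(n : ℝ)|)
    (m : ℝ) (hm : ∀ x : ℝ, 0 < x → x < 1 → m ≤ ∑' n : ℤ, (1 / |x + n| - κ n))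
    (r x : ℝ) (hr : 0 ≤ r) (hr' : r ≤ 1 / 4)
    (hn : ∀ n : ℤ, 0 < r ^ 2 + (x + n) ^ 2) :
    m - r * ∑' n : ℤ, 16 * (1 / (n : ℝ) ^ 2) ≤
      ∑' n : ℤ, (1 / Real.sqrt (r ^ 2 + (x + n) ^ 2) - κ n) := by
  have key : ∀ y : ℝ, 0 ≤ y → y ≤ 1 / 2 → (∀ n : ℤ, 0 < r ^ 2 + (y + n) ^ 2) →
      m - r * ∑' n : ℤ, 16 * (1 / (n : ℝ) ^ 2) ≤
      ∑' n : ℤ, (1 / Real.sqrt (r ^ 2 + (y + n) ^ 2) - κ n) := by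
    intro y hy hy' hny
    have hp : 0 < y + r := by
      rcases hy.eq_or_lt with h | h
      · rcases hr.eq_or_lt with h2 | h2
        · have := hny 0
          simp [← h, ← h2] at this
        · linarith
      · linarith
    have h1 := hm (y + r) hp (by linarith)
    have sw := (aux_sq_summable.mul_left 16).mul_left r
    have s0 := aux_summable0 κ hκ (y + r)
    rw [← tsum_mul_left]
    refine le_trans (sub_le_sub_right h1 _) ?_
    rw [← s0.tsum_sub sw]
    refine (s0.sub sw).tsum_le_tsum ?_ (aux_summable κ hκ r y hr)
    intro n
    have := aux_term r y hr hr' hy hy' hp n (hny n)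
    linarith
  have hper := aux_period κ hκ r (x - round x) hr (round x)
  rw [sub_add_cancel] at hper
  rw [hper]
  have hab := abs_sub_round x
  have hn' : ∀ n : ℤ, 0 < r ^ 2 + (x - round x + n) ^ 2 := by
    intro n
    have := hn (n - round x)
    push_cast at this
    convert this using 3
    ring
  generalize x - (round x : ℝ) = y at *
  rcases le_total 0 y with h | h
  · exact key y h ((le_abs_self y).trans hab) hn'
  · rw [← aux_reflect κ hκ r y]
    refine key (-y) (by linarith) ((neg_le_abs y).trans hab) ?_
    intro n
    have := hn' (-n)
    push_cast at this
    convert this using 2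
    ring

/-- under the positivity condition (**) — `S₁(0,0) > −inf_{x∈(0,1)} h(x)`
with `h(x) = (1/2)Σ_{n∈ℤ}[1/|x+n| − κ(n)]` — the generalized Ooguri–Vafa potential
`V₀` is positive near the singular locus. -/
theorem stmt18 (κ : ℤ → ℝ) (hκ0 : κ 0 = 0) (hκ : ∀ n : ℤ, n ≠ 0 → κ n = 1 / |(n : ℝ)|)
    (h : ℝ → ℝ)
    (hh : ∀ x : ℝ, (∀ n : ℤ, x ≠ (n : ℝ)) →
      h x = (1 / 2) * ∑' n : ℤ, (1 / |x + n| - κ n))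
    (R : ℝ) (hR : 0 < R)
    (S : ℝ × ℝ → ℝ) (hS : ContDiff ℝ (⊤ : ℕ∞) S)
    (S₁ S₂ : ℝ × ℝ → ℝ)
    (hS₁ : ∀ p, S₁ p = fderiv ℝ S p (1, 0))
    (hS₂ : ∀ p, S₂ p = fderiv ℝ S p (0, 1))
    (hharm : ∀ p : ℝ × ℝ, fderiv ℝ S₁ p (1, 0) + fderiv ℝ S₂ p (0, 1) = 0)
    (hS0 : S (0, 0) = 0)
    (hpos : S₁ (0, 0) > - sInf (h '' Set.Ioo (0 : ℝ) 1))
    (V₀ : ℝ → ℝ → ℝ → ℝ)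
    (hV₀ : ∀ c₁ c₂ θ : ℝ, V₀ c₁ c₂ θ = (R / (4 * Real.pi)) *
      ((∑' n : ℤ, (1 / Real.sqrt (R ^ 2 * (c₁ ^ 2 + c₂ ^ 2) + (θ / (2 * Real.pi) + n) ^ 2)
          - κ n)) + 2 * S₁ (c₁, c₂))) :
    ∃ ε > 0, ∀ c₁ c₂ θ : ℝ,
      (∀ n : ℤ, 0 < R ^ 2 * (c₁ ^ 2 + c₂ ^ 2) + (θ / (2 * Real.pi) + n) ^ 2) →
      c₁ ^ 2 + c₂ ^ 2 < ε ^ 2 → 0 < V₀ c₁ c₂ θ := by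
  set C : ℝ := ∑' n : ℤ, 16 * (1 / (n : ℝ) ^ 2) with hC
  have hC0 : 0 ≤ C := tsum_nonneg (fun n => by positivity)
  set m : ℝ := sInf (h '' Set.Ioo (0 : ℝ) 1) with hm
  have hni : ∀ x : ℝ, 0 < x → x < 1 → ∀ n : ℤ, x ≠ (n : ℝ) := by
    intro x h0 h1 n hx
    rw [hx] at h0 h1
    have a : 0 < n := by exact_mod_cast h0
    have b : n < 1 := by exact_mod_cast h1
    omega
  have hbdd : BddBelow (h '' Set.Ioo (0 : ℝ) 1) := by
    refine ⟨(1 / 2) * ∑' n : ℤ, -(1 / (n : ℝ) ^ 2), ?_⟩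
    rintro _ ⟨x, ⟨h0, h1⟩, rfl⟩
    rw [hh x (hni x h0 h1)]
    have := aux_bdd κ hκ0 hκ x h0 h1
    linarith
  have hm2 : ∀ x : ℝ, 0 < x → x < 1 → 2 * m ≤ ∑' n : ℤ, (1 / |x + n| - κ n) := by
    intro x h0 h1
    have h2 : m ≤ h x := csInf_le hbdd ⟨x, ⟨h0, h1⟩, rfl⟩
    rw [hh x (hni x h0 h1)] at h2
    linarith
  have hcont : Continuous S₁ := by
    have : S₁ = fun p => fderiv ℝ S p (1, 0) := funext hS₁
    rw [this]
    exact (hS.continuous_fderiv (by simp)).clm_apply continuous_const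
  obtain ⟨η, hη⟩ : ∃ η : ℝ, η = S₁ (0, 0) + m := ⟨_, rfl⟩
  have hη0 : 0 < η := by linarith
  obtain ⟨δ, hδ, hδS⟩ := Metric.continuousAt_iff.1 (hcont.continuousAt (x := ((0, 0) : ℝ × ℝ)))
    (η / 2) (by linarith)
  refine ⟨min δ (min (1 / 4 / R) (η / (R * (C + 1)))), by positivity, ?_⟩
  intro c₁ c₂ θ hn hc
  set ε := min δ (min (1 / 4 / R) (η / (R * (C + 1)))) with hε
  have hεpos : 0 < ε := by positivity
  set ρ := Real.sqrt (c₁ ^ 2 + c₂ ^ 2) with hρ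
  have hρ0 : 0 ≤ ρ := Real.sqrt_nonneg _
  have hρ2 : ρ ^ 2 = c₁ ^ 2 + c₂ ^ 2 := Real.sq_sqrt (by positivity)
  have hρε : ρ < ε := by
    apply lt_of_pow_lt_pow_left₀ 2 hεpos.le
    rw [hρ2]; exact hc
  have hρδ : ρ < δ := hρε.trans_le (min_le_left _ _)
  have hr1 : ρ < 1 / 4 / R := hρε.trans_le ((min_le_right _ _).trans (min_le_left _ _))
  have hr2 : ρ < η / (R * (C + 1)) := hρε.trans_le ((min_le_right _ _).trans (min_le_right _ _))
  rw [lt_div_iff₀ hR] at hr1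
  rw [lt_div_iff₀ (by positivity)] at hr2
  have hrr : R ^ 2 * (c₁ ^ 2 + c₂ ^ 2) = (R * ρ) ^ 2 := by rw [mul_pow, hρ2]
  have hS' : dist ((c₁, c₂) : ℝ × ℝ) (0, 0) < δ := by
    rw [Prod.dist_eq]
    simp only [Real.dist_eq, sub_zero]
    have a1 : |c₁| ≤ ρ := Real.abs_le_sqrt (by nlinarith [sq_nonneg c₂])
    have a2 : |c₂| ≤ ρ := Real.abs_le_sqrt (by nlinarith [sq_nonneg c₁])
    exact (max_le a1 a2).trans_lt hρδ
  have hS'' := hδS hS'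
  rw [Real.dist_eq, abs_lt] at hS''
  rw [hV₀]
  rw [hrr] at hn ⊢
  have hmain := aux_main κ hκ (2 * m) hm2 (R * ρ) (θ / (2 * Real.pi)) (by positivity)
    (by linarith) hn
  rw [← hC] at hmain
  have hRρ : 0 ≤ R * ρ := by positivity
  have : R * ρ * C < η := by nlinarith
  apply mul_pos
  · have := Real.pi_pos
    positivity
  · linarith [hS''.1]
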